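/- Let N, d, p, q be positive integers with q > (6d+1)·p. Let g, r ∈ T(d,d), f ∈ T(d+1,d), and let m ∈ ℤ[x] have degree < N with all coefficients of absolute value at most p/2. Suppose a ∈ ℤ[x] has degree < N, every coefficient of a lies in the interval (−q/2, q/2], and a ≡ p·(g ⋆ r) + f ⋆ m (mod q, x^N − 1). Then a equals p·(g ⋆ r) + f ⋆ m exactly (as the degree < N representative in ℤ[x]), not merely modulo q. -/

import Mathlib

open Polynomial

/-- The convolution product `a ⋆ b` in `R = ℤ[x]/(x^N − 1)`: the unique
representative of degree < N of `a·b` modulo `x^N − 1`, i.e. the remainder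
of `a·b` upon division by the monic polynomial `x^N − 1`. -/
noncomputable def conv (N : ℕ) (a b : ℤ[X]) : ℤ[X] :=
  (a * b) %ₘ (X ^ N - 1)

/-- `Tern N d₁ d₂ a` says `a` is a ternary polynomial in `T(d₁,d₂)`:
`a` has degree < N, exactly `d₁` coefficients equal to `1`, exactly `d₂`
coefficients equal to `−1`, and all other coefficients equal to `0`. -/
def Tern (N d₁ d₂ : ℕ) (a : ℤ[X]) : Prop :=
  a.degree < (N : WithBot ℕ) ∧
  ((Finset.range N).filter (fun i => a.coeff i = 1)).card = d₁ ∧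
  ((Finset.range N).filter (fun i => a.coeff i = -1)).card = d₂ ∧
  ∀ i, a.coeff i = 0 ∨ a.coeff i = 1 ∨ a.coeff i = -1

/-- `ModCong N q u v` is the congruence `u ≡ v (mod q, x^N − 1)`:
`u − v` lies in the ideal of `ℤ[x]` generated by `q` and `x^N − 1`. -/
def ModCong (N : ℕ) (q : ℤ) (u v : ℤ[X]) : Prop :=
  u - v ∈ Ideal.span ({C q, X ^ N - 1} : Set ℤ[X])

theorem monic_X_pow_sub_one {N : ℕ} (hN : 0 < N) : (X ^ N - 1 : ℤ[X]).Monic := by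
  simpa using monic_X_pow_sub_C (1 : ℤ) hN.ne'

theorem degree_X_pow_sub_one {N : ℕ} (hN : 0 < N) : (X ^ N - 1 : ℤ[X]).degree = N := by
  simpa using degree_X_pow_sub_C hN (1 : ℤ)

theorem degree_modByMonic_X_pow_sub_one_lt {N : ℕ} (hN : 0 < N) (a : ℤ[X]) :
    (a %ₘ (X ^ N - 1)).degree < (N : WithBot ℕ) :=
  degree_X_pow_sub_one hN ▸ degree_modByMonic_lt a (monic_X_pow_sub_one hN)

theorem X_mul_modByMonic_X_pow_sub_one {N : ℕ} (hN : 0 < N) {b : ℤ[X]}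
    (hb : b.degree < (N : WithBot ℕ)) :
    (X * b) %ₘ (X ^ N - 1) = X * b - C (b.coeff (N - 1)) * (X ^ N - 1) := by
  refine (div_modByMonic_unique (C (b.coeff (N - 1))) _ (monic_X_pow_sub_one hN)
    ⟨by ring, ?_⟩).2
  rw [degree_X_pow_sub_one hN, degree_lt_iff_coeff_zero]
  intro k hk
  obtain ⟨n, rfl⟩ : ∃ n, N = n + 1 := ⟨N - 1, by omega⟩
  obtain ⟨j, rfl⟩ : ∃ j, k = j + 1 := ⟨k - 1, by omega⟩
  rw [degree_lt_iff_coeff_zero] at hb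
  rcases eq_or_ne j n with rfl | hjn
  · simp [coeff_X_pow, coeff_one]
  · simp [coeff_X_pow, coeff_one, hjn, hb j (by omega)]

theorem abs_coeff_X_mul_modByMonic_le {N : ℕ} (hN : 0 < N) {B : ℤ} {b : ℤ[X]}
    (hb : b.degree < (N : WithBot ℕ)) (hB : ∀ k, |b.coeff k| ≤ B) (k : ℕ) :
    |((X * b) %ₘ (X ^ N - 1)).coeff k| ≤ B := by
  rcases le_or_gt N k with hk | hk
  · rw [(degree_lt_iff_coeff_zero _ _).1 (degree_modByMonic_X_pow_sub_one_lt hN _) k hk, abs_zero]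
    exact (abs_nonneg _).trans (hB 0)
  · rw [X_mul_modByMonic_X_pow_sub_one hN hb]
    rcases k with _ | k
    · simpa [coeff_X_pow, hN.ne] using hB (N - 1)
    · simpa [coeff_X_pow, coeff_one, hk.ne] using hB k

theorem abs_coeff_X_pow_mul_modByMonic_le {N : ℕ} (hN : 0 < N) {B : ℤ} {b : ℤ[X]}
    (hb : b.degree < (N : WithBot ℕ)) (hB : ∀ k, |b.coeff k| ≤ B) (i k : ℕ) :
    |((X ^ i * b) %ₘ (X ^ N - 1)).coeff k| ≤ B := by
  induction i generalizing k with
  | zero =>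
    rw [pow_zero, one_mul, (modByMonic_eq_self_iff (monic_X_pow_sub_one hN)).2
      (by rwa [degree_X_pow_sub_one hN])]
    exact hB k
  | succ i ih =>
    have h : (X ^ (i + 1) * b) %ₘ (X ^ N - 1)
        = (X * ((X ^ i * b) %ₘ (X ^ N - 1))) %ₘ (X ^ N - 1) := by
      refine modByMonic_eq_of_dvd_sub (monic_X_pow_sub_one hN)
        ⟨X * ((X ^ i * b) /ₘ (X ^ N - 1)), ?_⟩
      linear_combination -(X : ℤ[X]) * modByMonic_add_div (X ^ i * b) (X ^ N - 1 : ℤ[X])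
    rw [h]
    exact abs_coeff_X_mul_modByMonic_le hN (degree_modByMonic_X_pow_sub_one_lt hN _) ih k

/-- The sup norm of `a ⋆ b` is at most the `ℓ¹` norm of `a` times the sup norm of `b`. -/
theorem abs_coeff_conv_le {N : ℕ} (hN : 0 < N) {B : ℤ} {a b : ℤ[X]}
    (ha : a.degree < (N : WithBot ℕ)) (hb : b.degree < (N : WithBot ℕ))
    (hB : ∀ k, |b.coeff k| ≤ B) (k : ℕ) :
    |(conv N a b).coeff k| ≤ (∑ i ∈ Finset.range N, |a.coeff i|) * B := by
  have hsum : conv N a b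
      = ∑ i ∈ Finset.range N, a.coeff i • ((X ^ i * b) %ₘ (X ^ N - 1)) := by
    have hnat : a.natDegree < N := by
      rcases eq_or_ne a 0 with rfl | h0
      · simpa using hN
      · exact (natDegree_lt_iff_degree_lt h0).2 ha
    have h : a * b = ∑ i ∈ Finset.range N, a.coeff i • (X ^ i * b) := by
      conv_lhs => rw [a.as_sum_range' N hnat]
      rw [Finset.sum_mul]
      refine Finset.sum_congr rfl fun i _ => ?_
      rw [← C_mul_X_pow_eq_monomial, smul_eq_C_mul, mul_assoc]
    change modByMonicHom (X ^ N - 1) (a * b) = _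
    rw [h, map_sum]
    exact Finset.sum_congr rfl fun i _ => map_smul _ _ _
  rw [hsum, finsetSum_coeff, Finset.sum_mul]
  refine (Finset.abs_sum_le_sum_abs _ _).trans (Finset.sum_le_sum fun i _ => ?_)
  rw [coeff_smul, smul_eq_mul, abs_mul]
  exact mul_le_mul_of_nonneg_left (abs_coeff_X_pow_mul_modByMonic_le hN hb hB i k) (abs_nonneg _)

theorem Tern.abs_coeff_le_one {N d₁ d₂ : ℕ} {a : ℤ[X]} (ha : Tern N d₁ d₂ a) (i : ℕ) :
    |a.coeff i| ≤ 1 := by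
  rcases ha.2.2.2 i with h | h | h <;> simp [h]

theorem Tern.sum_abs_coeff {N d₁ d₂ : ℕ} {a : ℤ[X]} (ha : Tern N d₁ d₂ a) :
    ∑ i ∈ Finset.range N, |a.coeff i| = d₁ + d₂ := by
  obtain ⟨-, h₁, h₂, h⟩ := ha
  rw [← h₁, ← h₂, Finset.card_filter, Finset.card_filter]
  push_cast
  rw [← Finset.sum_add_distrib]
  refine Finset.sum_congr rfl fun i _ => ?_
  rcases h i with h | h | h <;> simp [h]

theorem ModCong.dvd_coeff_sub {N : ℕ} (hN : 0 < N) {q : ℤ} {u v : ℤ[X]} (h : ModCong N q u v)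
    (hu : u.degree < (N : WithBot ℕ)) (hv : v.degree < (N : WithBot ℕ)) (k : ℕ) :
    q ∣ u.coeff k - v.coeff k := by
  obtain ⟨s, t, hst⟩ := Ideal.mem_span_pair.1 h
  have hdeg : (u - v).degree < (X ^ N - 1 : ℤ[X]).degree := by
    rw [degree_X_pow_sub_one hN]
    exact (degree_sub_le u v).trans_lt (max_lt hu hv)
  have hmod : u - v = q • (s %ₘ (X ^ N - 1)) := by
    rw [← (modByMonic_eq_self_iff (monic_X_pow_sub_one hN)).2 hdeg, ← smul_modByMonic]
    refine modByMonic_eq_of_dvd_sub (monic_X_pow_sub_one hN) ⟨t, ?_⟩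
    rw [← hst, smul_eq_C_mul]
    ring
  rw [← coeff_sub, hmod, coeff_smul, smul_eq_mul]
  exact dvd_mul_right _ _

/-- if `q > (6d+1)·p`, `g, r ∈ T(d,d)`, `f ∈ T(d+1,d)`, `m` has
degree < N with coefficients of absolute value at most `p/2`, and `a` has
degree < N with every coefficient in `(−q/2, q/2]` and satisfies
`a ≡ p·(g ⋆ r) + f ⋆ m (mod q, x^N − 1)`, then `a = p·(g ⋆ r) + f ⋆ m`
exactly in `ℤ[x]`. -/
theorem centered_lift_exact (N d : ℕ) (hN : 0 < N) (hd : 0 < d) (p q : ℤ)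
    (hp : 0 < p) (hq : (6 * (d : ℤ) + 1) * p < q)
    (g r f m a : ℤ[X]) (hg : Tern N d d g) (hr : Tern N d d r)
    (hf : Tern N (d + 1) d f) (hm : m.degree < (N : WithBot ℕ))
    (hmc : ∀ i, 2 * |m.coeff i| ≤ p)
    (hadeg : a.degree < (N : WithBot ℕ))
    (hacoeff : ∀ i, -q < 2 * a.coeff i ∧ 2 * a.coeff i ≤ q)
    (hacong : ModCong N q a (C p * conv N g r + conv N f m)) :
    a = C p * conv N g r + conv N f m := by
  have hbdeg : (C p * conv N g r + conv N f m).degree < (N : WithBot ℕ) := by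
    rw [← smul_eq_C_mul]
    exact (degree_add_le _ _).trans_lt (max_lt
      ((degree_smul_le _ _).trans_lt (degree_modByMonic_X_pow_sub_one_lt hN _))
      (degree_modByMonic_X_pow_sub_one_lt hN _))
  ext k
  have hgr := abs_coeff_conv_le hN hg.1 hr.1 hr.abs_coeff_le_one k
  have hfm := abs_coeff_conv_le hN hf.1 hm (B := p / 2)
    (fun i => by have := hmc i; omega) k
  rw [hg.sum_abs_coeff] at hgr
  rw [hf.sum_abs_coeff] at hfm
  push_cast at hfm
  have hbound : 2 * |(C p * conv N g r + conv N f m).coeff k| < q := by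
    rw [coeff_add, coeff_C_mul]
    have h₁ := abs_add_le (p * (conv N g r).coeff k) ((conv N f m).coeff k)
    rw [abs_mul, abs_of_pos hp] at h₁
    have h₂ := mul_le_mul_of_nonneg_left hgr hp.le
    have h₃ : 2 * (p / 2) ≤ p := by omega
    have h₄ := mul_le_mul_of_nonneg_left h₃ (by positivity : (0 : ℤ) ≤ d + 1 + d)
    linarith
  have hdvd := hacong.dvd_coeff_sub hN hadeg hbdeg k
  obtain ⟨h₁, h₂⟩ := hacoeff k
  have h₃ := abs_lt.1 (by simpa [abs_mul] using hbound :
    |2 * (C p * conv N g r + conv N f m).coeff k| < q)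
  exact sub_eq_zero.1 (Int.eq_zero_of_abs_lt_dvd hdvd (abs_lt.2 ⟨by linarith, by linarith⟩))
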